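/- For every real number q > 0, ∫₀¹ log(x² + q)/(1 + x²) dx = (π/2)·log(1 + √q) + Ti₂( (√q − 1)/(√q + 1) ) − G. -/

import Mathlib

open Real MeasureTheory intervalIntegral Finset

/-- Inverse tangent integral Ti₂(x) = ∫₀ˣ arctan u / u du. -/
noncomputable def Ti2 (x : ℝ) : ℝ := ∫ u in (0:ℝ)..x, Real.arctan u / u

/-- Catalan's constant G = Σ_{k≥0} (-1)^k/(2k+1)². -/
noncomputable def catalanG : ℝ := ∑' k : ℕ, (-1 : ℝ) ^ k / (2 * (k : ℝ) + 1) ^ 2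

open Filter Topology Set in
lemma aux_cont : Continuous (dslope Real.arctan 0) := by
  rw [← continuousOn_univ, continuousOn_dslope (by simp)]
  exact ⟨Real.continuous_arctan.continuousOn, Real.differentiable_arctan.differentiableAt⟩

lemma aux_dslope (u : ℝ) (hu : u ≠ 0) : dslope Real.arctan 0 u = Real.arctan u / u := by
  rw [dslope_of_ne _ hu, slope_def_field]; simp

lemma Ti2_eq (x : ℝ) : Ti2 x = ∫ u in (0:ℝ)..x, dslope Real.arctan 0 u := by
  unfold Ti2
  apply intervalIntegral.integral_congr_ae
  have : ∀ᵐ u : ℝ, u ≠ 0 := by simp [ae_iff, measure_singleton]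
  filter_upwards [this] with u hu _
  rw [aux_dslope u hu]

lemma Ti2_deriv (x : ℝ) : HasDerivAt Ti2 (dslope Real.arctan 0 x) x := by
  have : Ti2 = fun x => ∫ u in (0:ℝ)..x, dslope Real.arctan 0 u := funext Ti2_eq
  rw [this]
  exact (aux_cont.integral_hasStrictDerivAt 0 x).hasDerivAt

lemma Ti2_one : Ti2 1 = catalanG := by
  unfold Ti2 catalanG
  rw [intervalIntegral.integral_of_le zero_le_one]
  have hI : ∀ k : ℕ, ∫ u in Set.Ioc (0:ℝ) 1, u ^ (2*k) = 1 / (2 * (k:ℝ) + 1) := by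
    intro k
    rw [← intervalIntegral.integral_of_le zero_le_one, integral_pow]
    simp
  have hint : ∀ k : ℕ, Integrable (fun u : ℝ => (-1:ℝ)^k / (2*(k:ℝ)+1) * u^(2*k))
      (volume.restrict (Set.Ioc (0:ℝ) 1)) := by
    intro k
    have : Continuous (fun u : ℝ => (-1:ℝ)^k / (2*(k:ℝ)+1) * u^(2*k)) := by fun_prop
    exact (this.intervalIntegrable 0 1).1
  have hs := hasSum_integral_of_summable_integral_norm hint ?_
  · have h1 : ∀ k : ℕ, ∫ u in Set.Ioc (0:ℝ) 1, (-1:ℝ)^k / (2*(k:ℝ)+1) * u^(2*k)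
        = (-1 : ℝ) ^ k / (2 * (k : ℝ) + 1) ^ 2 := by
      intro k
      rw [MeasureTheory.integral_const_mul, hI]
      field_simp
    simp only [h1] at hs
    rw [hs.tsum_eq]
    apply MeasureTheory.integral_congr_ae
    have : ∀ᵐ u : ℝ, u ≠ 1 := by simp [ae_iff, measure_singleton]
    filter_upwards [ae_restrict_mem measurableSet_Ioc, ae_restrict_of_ae this] with u hu hu1
    have hlt : ‖u‖ < 1 := by
      rw [Real.norm_eq_abs, abs_of_pos hu.1]; exact lt_of_le_of_ne hu.2 hu1
    have h2 := (Real.hasSum_arctan hlt).div_const u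
    rw [← h2.tsum_eq]
    congr 1
    ext k
    have := hu.1.ne'
    push_cast
    field_simp
    try ring
  · have h1 : ∀ k : ℕ, ∫ u in Set.Ioc (0:ℝ) 1, ‖(-1:ℝ)^k / (2*(k:ℝ)+1) * u^(2*k)‖
        = 1 / (2 * (k : ℝ) + 1) ^ 2 := by
      intro k
      have : ∀ u : ℝ, ‖(-1:ℝ)^k / (2*(k:ℝ)+1) * u^(2*k)‖ = 1 / (2*(k:ℝ)+1) * u^(2*k) := by
        intro u
        rw [norm_mul, norm_div, norm_pow, norm_neg, norm_one, one_pow, pow_mul, Real.norm_eq_abs,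
          Real.norm_eq_abs, abs_of_nonneg (by positivity : (0:ℝ) ≤ 2*(k:ℝ)+1),
          abs_of_nonneg (by positivity : (0:ℝ) ≤ (u^2)^k)]
      simp only [this]
      rw [MeasureTheory.integral_const_mul, hI]
      field_simp
    simp only [h1]
    have h3 := (summable_nat_add_iff 1).2 (Real.summable_one_div_nat_pow.2 (one_lt_two))
    refine Summable.of_nonneg_of_le (fun k => by positivity) (fun k => ?_) h3
    push_cast
    gcongr
    linarith [(Nat.cast_nonneg k : (0:ℝ) ≤ k)]

noncomputable def auxL (s : ℝ) : ℝ := ∫ x in (0:ℝ)..1, Real.log (x ^ 2 + s ^ 2) / (1 + x ^ 2)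

lemma aux_contL (s : ℝ) (hs : 0 < s) :
    Continuous fun x : ℝ => Real.log (x ^ 2 + s ^ 2) / (1 + x ^ 2) := by
  refine Continuous.div (Continuous.log (by fun_prop) ?_) (by fun_prop) ?_ <;> intro x <;> positivity

lemma auxL_deriv (s : ℝ) (hs : 0 < s) :
    HasDerivAt auxL (∫ x in (0:ℝ)..1, 2 * s / ((x ^ 2 + s ^ 2) * (1 + x ^ 2))) s := by
  have hpos : ∀ y ∈ Metric.ball s (s/2), s/2 < y := by
    intro y hy
    rw [Metric.mem_ball, Real.dist_eq, abs_lt] at hy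
    linarith [hy.1]
  refine (intervalIntegral.hasDerivAt_integral_of_dominated_loc_of_deriv_le
    (F := fun s x => Real.log (x ^ 2 + s ^ 2) / (1 + x ^ 2))
    (F' := fun s x => 2 * s / ((x ^ 2 + s ^ 2) * (1 + x ^ 2)))
    (bound := fun _ => 4 / s) (Metric.ball_mem_nhds s (half_pos hs)) ?_ ?_ ?_ ?_ ?_ ?_).2
  · filter_upwards [lt_mem_nhds hs] with y hy
    exact (aux_contL y hy).aestronglyMeasurable
  · exact (aux_contL s hs).intervalIntegrable _ _
  · have : Continuous fun x : ℝ => 2 * s / ((x ^ 2 + s ^ 2) * (1 + x ^ 2)) := by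
      refine Continuous.div (by fun_prop) (by fun_prop) ?_
      intro x; positivity
    exact this.aestronglyMeasurable
  · refine Filter.Eventually.of_forall fun x _ y hy => ?_
    have h := hpos y hy
    have hy0 : 0 < y := by linarith
    rw [Real.norm_eq_abs, abs_of_nonneg (by positivity), div_le_div_iff₀ (by positivity) hs]
    have h1 : y ^ 2 * 1 ≤ (x ^ 2 + y ^ 2) * (1 + x ^ 2) := by
      gcongr <;> nlinarith [sq_nonneg x]
    nlinarith
  · simp
  · refine Filter.Eventually.of_forall fun x _ y hy => ?_
    have h := hpos y hy
    have hy0 : 0 < y := by linarith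
    have h1 : HasDerivAt (fun y : ℝ => x ^ 2 + y ^ 2) (2 * y) y := by
      simpa using (hasDerivAt_pow 2 y).const_add (x ^ 2)
    have h2 := (h1.log (by positivity)).div_const (1 + x ^ 2)
    rwa [div_div] at h2

lemma auxL_int (s : ℝ) (hs : 0 < s) (h1 : s ≠ 1) :
    ∫ x in (0:ℝ)..1, 2 * s / ((x ^ 2 + s ^ 2) * (1 + x ^ 2)) =
      2 * s / (s ^ 2 - 1) * (π / 4 - (π / 2 - Real.arctan s) / s) := by
  have hne : s ^ 2 - 1 ≠ 0 := by
    have : s ^ 2 - 1 = (s - 1) * (s + 1) := by ring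
    rw [this]
    exact mul_ne_zero (sub_ne_zero.2 h1) (by positivity)
  have hd : ∀ x ∈ Set.uIcc (0:ℝ) 1, HasDerivAt
      (fun x => 2 * s / (s ^ 2 - 1) * (Real.arctan x - Real.arctan (x / s) / s))
      (2 * s / ((x ^ 2 + s ^ 2) * (1 + x ^ 2))) x := by
    intro x _
    have ha := ((hasDerivAt_id x).div_const s).arctan.div_const s
    have hb := ((Real.hasDerivAt_arctan x).sub ha).const_mul (2 * s / (s ^ 2 - 1))
    refine hb.congr_deriv ?_
    have e1 : (1 + x ^ 2) ≠ 0 := by positivity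
    have e2 : (x ^ 2 + s ^ 2) ≠ 0 := by positivity
    have e3 : (1 + (x / s) ^ 2) = (x ^ 2 + s ^ 2) / s ^ 2 := by field_simp; ring
    simp only [id]
    rw [e3]
    field_simp
    ring
  have hc : Continuous fun x : ℝ => 2 * s / ((x ^ 2 + s ^ 2) * (1 + x ^ 2)) := by
    refine Continuous.div (by fun_prop) (by fun_prop) ?_
    intro x; positivity
  rw [intervalIntegral.integral_eq_sub_of_hasDerivAt hd (hc.intervalIntegrable _ _)]
  simp only [zero_div, Real.arctan_zero, Real.arctan_one, sub_zero, mul_zero]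
  rw [one_div, Real.arctan_inv_of_pos hs]

noncomputable def auxF (s : ℝ) : ℝ :=
  auxL s - ((π / 2) * Real.log (1 + s) + Ti2 ((s - 1) / (s + 1)) - catalanG)

lemma auxF_deriv (s : ℝ) (hs : 0 < s) : HasDerivAt auxF
    ((∫ x in (0:ℝ)..1, 2 * s / ((x ^ 2 + s ^ 2) * (1 + x ^ 2))) -
      (π / 2 * (1 / (1 + s)) + dslope Real.arctan 0 ((s - 1) / (s + 1)) * (2 / (s + 1) ^ 2))) s := by
  have hp : s + 1 ≠ 0 := by positivity
  have h1 : HasDerivAt (fun s : ℝ => (s - 1) / (s + 1)) (2 / (s + 1) ^ 2) s := by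
    refine (((hasDerivAt_id s).sub_const 1).div ((hasDerivAt_id s).add_const 1) hp).congr_deriv ?_
    simp only [id]
    ring
  have h2 : HasDerivAt (fun s : ℝ => Real.log (1 + s)) (1 / (1 + s)) s :=
    ((hasDerivAt_id s).const_add 1).log (by simp only [id]; positivity)
  have h3 := HasDerivAt.comp s (Ti2_deriv ((s - 1) / (s + 1))) h1
  exact (auxL_deriv s hs).sub (((h2.const_mul (π / 2)).add h3).sub_const catalanG)

lemma aux_arctan (s : ℝ) (hs : 0 < s) :
    Real.arctan ((s - 1) / (s + 1)) = Real.arctan s - π / 4 := by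
  have h := Real.arctan_add (x := s) (y := -1) (by linarith)
  rw [Real.arctan_neg, Real.arctan_one] at h
  rw [sub_eq_add_neg (Real.arctan s), h]
  congr 1
  ring

lemma auxF_deriv0 (s : ℝ) (hs : 0 < s) (h1 : s ≠ 1) : HasDerivAt auxF 0 s := by
  refine (auxF_deriv s hs).congr_deriv ?_
  have e1 : s - 1 ≠ 0 := sub_ne_zero.2 h1
  have e2 : s + 1 ≠ 0 := by positivity
  have e3 : s ^ 2 - 1 = (s - 1) * (s + 1) := by ring
  rw [auxL_int s hs h1, aux_dslope _ (div_ne_zero e1 e2), aux_arctan s hs, e3, add_comm 1 s]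
  field_simp
  ring

lemma auxF_eq (a b : ℝ) (ha : 0 < a) (hab : a < b) (h : ∀ x ∈ Set.Ioo a b, x ≠ 1) :
    auxF a = auxF b := by
  obtain ⟨c, hc, hc'⟩ := exists_hasDerivAt_eq_slope auxF (fun _ => 0) hab
    (fun x hx => (auxF_deriv x (lt_of_lt_of_le ha hx.1)).continuousAt.continuousWithinAt)
    (fun x hx => auxF_deriv0 x (lt_trans ha hx.1) (h x hx))
  have : b - a ≠ 0 := by linarith
  field_simp at hc'
  linarith

lemma auxF_const (s : ℝ) (hs : 0 < s) : auxF s = auxF 1 := by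
  rcases lt_trichotomy s 1 with h | h | h
  · exact auxF_eq s 1 hs h fun x hx => hx.2.ne
  · rw [h]
  · exact (auxF_eq 1 s one_pos h fun x hx => hx.1.ne').symm

lemma auxL_bound (s : ℝ) (hs : 0 < s) : |auxL s - π / 2 * Real.log s| ≤ (s ^ 2)⁻¹ := by
  have hi : ∫ x in (0:ℝ)..1, 2 * Real.log s * (1 / (1 + x ^ 2)) = π / 2 * Real.log s := by
    rw [intervalIntegral.integral_const_mul, integral_one_div_one_add_sq]
    simp; ring
  have hc : Continuous fun x : ℝ => 2 * Real.log s * (1 / (1 + x ^ 2)) := by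
    refine Continuous.mul (by fun_prop) (Continuous.div (by fun_prop) (by fun_prop) ?_)
    intro x; positivity
  rw [auxL, ← hi, ← intervalIntegral.integral_sub ((aux_contL s hs).intervalIntegrable _ _)
    (hc.intervalIntegrable _ _), ← Real.norm_eq_abs]
  have := intervalIntegral.norm_integral_le_of_norm_le_const (a := (0:ℝ)) (b := 1)
    (C := (s ^ 2)⁻¹) (f := fun x : ℝ => Real.log (x ^ 2 + s ^ 2) / (1 + x ^ 2) -
      2 * Real.log s * (1 / (1 + x ^ 2))) ?_
  · simpa using this
  · intro x hx
    rw [Set.uIoc_of_le zero_le_one] at hx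
    have e : Real.log (x ^ 2 + s ^ 2) / (1 + x ^ 2) - 2 * Real.log s * (1 / (1 + x ^ 2))
        = Real.log (1 + x ^ 2 / s ^ 2) / (1 + x ^ 2) := by
      have : 1 + x ^ 2 / s ^ 2 = (x ^ 2 + s ^ 2) / s ^ 2 := by field_simp; ring
      rw [this, Real.log_div (by positivity) (by positivity), Real.log_pow]
      push_cast; ring
    have h0 : 0 ≤ x ^ 2 / s ^ 2 := by positivity
    have hl : 0 ≤ Real.log (1 + x ^ 2 / s ^ 2) := Real.log_nonneg (by linarith)
    rw [e, Real.norm_eq_abs, abs_of_nonneg (by positivity)]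
    calc _ ≤ Real.log (1 + x ^ 2 / s ^ 2) := div_le_self hl (by nlinarith [sq_nonneg x])
      _ ≤ x ^ 2 / s ^ 2 := by
        have := Real.log_le_sub_one_of_pos (by linarith : 0 < 1 + x ^ 2 / s ^ 2)
        linarith
      _ ≤ 1 / s ^ 2 := by
        gcongr
        nlinarith [hx.1, hx.2]
      _ = _ := one_div _

open Filter Topology in
lemma auxF_lim : Tendsto auxF atTop (𝓝 0) := by
  have t0 : Tendsto (fun s : ℝ => s⁻¹) atTop (𝓝 0) := tendsto_inv_atTop_zero
  have t1 : Tendsto (fun s : ℝ => auxL s - π / 2 * Real.log s) atTop (𝓝 0) := by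
    refine squeeze_zero_norm' (a := fun s : ℝ => (s ^ 2)⁻¹) ?_ ?_
    · filter_upwards [eventually_gt_atTop 0] with s hs using auxL_bound s hs
    · simpa using t0.pow 2
  have t2 : Tendsto (fun s : ℝ => π / 2 * Real.log (1 + s⁻¹)) atTop (𝓝 0) := by
    have : ContinuousAt (fun y : ℝ => π / 2 * Real.log (1 + y)) 0 := by
      refine ContinuousAt.mul continuousAt_const (ContinuousAt.log (by fun_prop) (by norm_num))
    simpa [Function.comp_def] using this.tendsto.comp t0
  have t3 : Tendsto (fun s : ℝ => Ti2 ((1 - s⁻¹) / (1 + s⁻¹))) atTop (𝓝 catalanG) := by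
    have hc : ContinuousAt (fun y : ℝ => Ti2 ((1 - y) / (1 + y))) 0 := by
      refine ContinuousAt.comp (f := fun y : ℝ => (1 - y) / (1 + y)) (g := Ti2)
        (Ti2_deriv _).continuousAt (ContinuousAt.div (by fun_prop) (by fun_prop) (by norm_num))
    have := hc.tendsto.comp t0
    simpa [Ti2_one, Function.comp_def] using this
  have t4 := (t1.sub t2).sub (t3.sub_const catalanG)
  simp only [sub_self] at t4
  refine t4.congr' ?_
  filter_upwards [eventually_gt_atTop 0] with s hs
  have e1 : (1 - s⁻¹) / (1 + s⁻¹) = (s - 1) / (s + 1) := by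
    have : s + 1 ≠ 0 := by positivity
    field_simp
  have e2 : 1 + s⁻¹ = (1 + s) / s := by field_simp; ring
  rw [e1, e2, Real.log_div (by positivity) hs.ne', auxF]
  ring

open Filter Topology in
lemma auxF_zero (s : ℝ) (hs : 0 < s) : auxF s = 0 := by
  rw [auxF_const s hs]
  refine tendsto_nhds_unique (tendsto_const_nhds.congr' ?_) auxF_lim
  filter_upwards [eventually_gt_atTop 0] with s hs using (auxF_const s hs).symm

theorem stmt_2 (q : ℝ) (hq : 0 < q) :
    ∫ x in (0:ℝ)..1, Real.log (x ^ 2 + q) / (1 + x ^ 2) =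
      (π / 2) * Real.log (1 + Real.sqrt q)
        + Ti2 ((Real.sqrt q - 1) / (Real.sqrt q + 1)) - catalanG := by
  have h := auxF_zero (Real.sqrt q) (Real.sqrt_pos.2 hq)
  rw [auxF, auxL, Real.sq_sqrt hq.le] at h
  exact sub_eq_zero.1 h
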